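/- Let 0 < λ < π/κ, let 𝔠 > 0, let 0 < c < 𝔠, and let C₀ > 0. Suppose K : (0,∞) × 𝒟 × 𝒟 → [0,∞) satisfies K(t, x, y) ≤ C₀ · R_{t,x}^{λ−1} R_{t,y}^{λ−1} J_{t,x} J_{t,y} · e^{−𝔠 |x−y|²/t} / t for all t > 0 and x, y ∈ 𝒟. Then there exists a finite constant C, depending only on λ, κ, 𝔠, c and C₀, such that K(t, x, y) / ( w_{1,λ}(x) w_{1,λ}(y) ) ≤ C · e^{−c |x−y|²/t} / w_{2,2λ}(B(x, √t)) for all t > 0 and x, y ∈ 𝒟, where w_{1,λ}(x) = |x|^{λ−1} ρ_𝒟(x). -/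

import Mathlib

open MeasureTheory Set Real
open scoped ENNReal

noncomputable section

abbrev E2 := EuclideanSpace ℝ (Fin 2)

/-- The planar angular domain with opening angle `κ`. -/
def Dset (κ : ℝ) : Set E2 :=
  {x | ∃ r φ : ℝ, 0 < r ∧ 0 < φ ∧ φ < κ ∧ x 0 = r * Real.cos φ ∧ x 1 = r * Real.sin φ}

/-- `B(x, r)`: the part of the Euclidean ball of radius `r` around `x` lying in `𝒟`. -/
def ballD (κ : ℝ) (x : E2) (r : ℝ) : Set E2 :=
  {y | y ∈ Dset κ ∧ dist y x < r}

/-- Geodesic (arc-length) distance between unit vectors of `S¹ ⊆ ℝ²`. -/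
def dS1 (u v : E2) : ℝ := Real.arccos (inner ℝ u v)

/-- The "windshield wiper" set `S(x, r)`; for `x = 0` the angular condition is vacuous
(convention `a/0 = ∞`). -/
def Sset (κ : ℝ) (x : E2) (r : ℝ) : Set E2 :=
  {y | y ∈ Dset κ ∧ |‖y‖ - ‖x‖| < r ∧ (x ≠ 0 → dS1 (‖x‖⁻¹ • x) (‖y‖⁻¹ • y) < r / ‖x‖)}

/-- Distance from `x` to the boundary of `𝒟`. -/
def rhoD (κ : ℝ) (x : E2) : ℝ := Metric.infDist x (frontier (Dset κ))

/-- The mixed power weight `w_{γ,ν}(x) = ρ_∘(x)^{ν-γ} ρ_𝒟(x)^γ`. -/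
def wgt (κ γ ν : ℝ) (x : E2) : ℝ := ‖x‖ ^ (ν - γ) * rhoD κ x ^ γ

/-- `w_{γ,ν}(E) = ∫_E w_{γ,ν} dx`, valued in `[0,∞]`. -/
def wMeas (κ γ ν : ℝ) (E : Set E2) : ℝ≥0∞ :=
  ∫⁻ x in E, ENNReal.ofReal (wgt κ γ ν x)

theorem lintegral_ball_zero_norm_rpow {a R : ℝ} (ha : -2 < a) (hR : 0 < R) :
    ∫⁻ y in Metric.ball (0 : E2) R, ENNReal.ofReal (‖y‖ ^ a)
      = ENNReal.ofReal (2 * π / (a + 2) * R ^ (a + 2)) := by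
  have hdim : Module.finrank ℝ E2 = 2 := by simp
  have hmul : ∀ y : ℝ, 0 < y → y * y ^ a = y ^ (a + 1) := fun y hy => by
    rw [rpow_add hy, rpow_one, mul_comm]
  have hint : IntegrableOn (fun y : E2 => ‖y‖ ^ a) (Metric.ball 0 R) := by
    rw [integrableOn_fun_norm_addHaar volume (f := fun r : ℝ => r ^ a), hdim]
    have h := intervalIntegral.intervalIntegrable_rpow' (a := 0) (b := R)
      (show -1 < a + 1 by linarith)
    rw [intervalIntegrable_iff_integrableOn_Ioo_of_le hR.le] at h
    refine h.congr_fun (fun y hy => ?_) measurableSet_Ioo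
    simp [hmul y hy.1]
  rw [← ofReal_integral_eq_lintegral_ofReal hint (ae_of_all _ fun y => by positivity)]
  congr 1
  calc ∫ y in Metric.ball (0 : E2) R, ‖y‖ ^ a
      = ∫ y : E2, (Iio R).indicator (fun r : ℝ => r ^ a) ‖y‖ := by
        rw [← integral_indicator measurableSet_ball]
        congr 1 with y
        simp [indicator]
    _ = 2 * π * ∫ y in Ioi (0 : ℝ), (Ioo 0 R).indicator (fun r : ℝ => r ^ (a + 1)) y := by
        rw [integral_fun_norm_addHaar volume, hdim]
        have hvol : (volume : Measure E2).real (Metric.ball 0 1) = π := by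
          simp [Measure.real, pi_pos.le]
        rw [hvol, nsmul_eq_mul, smul_eq_mul, ← mul_assoc]
        congr 1
        refine setIntegral_congr_fun measurableSet_Ioi fun y hy => ?_
        have hy : 0 < y := hy
        by_cases hyR : y < R <;> simp [indicator, hy, hyR, hmul y hy]
    _ = 2 * π / (a + 2) * R ^ (a + 2) := by
        rw [setIntegral_indicator measurableSet_Ioo,
          inter_eq_self_of_subset_right Ioo_subset_Ioi_self, ← integral_Ioc_eq_integral_Ioo,
          ← intervalIntegral.integral_of_le hR.le, integral_rpow (Or.inl (by linarith)),
          zero_rpow (by linarith), show a + 1 + 1 = a + 2 by ring]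
        ring

theorem lintegral_ball_norm_rpow_le_of_forall_le {a M s : ℝ} (x : E2) (hs : 0 < s)
    (hM : ∀ y ∈ Metric.ball x s, ‖y‖ ^ a ≤ M) :
    ∫⁻ y in Metric.ball x s, ENNReal.ofReal (‖y‖ ^ a) ≤ ENNReal.ofReal (π * s ^ 2 * M) := by
  calc ∫⁻ y in Metric.ball x s, ENNReal.ofReal (‖y‖ ^ a)
      ≤ ∫⁻ _ in Metric.ball x s, ENNReal.ofReal M :=
        setLIntegral_mono measurable_const fun y hy => ENNReal.ofReal_le_ofReal (hM y hy)
    _ = ENNReal.ofReal (π * s ^ 2 * M) := by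
        rw [setLIntegral_const, EuclideanSpace.volume_ball_fin_two,
          ← ENNReal.ofReal_pow hs.le, ← ENNReal.ofReal_mul (by positivity), mul_comm,
          ← ENNReal.ofReal_mul (by positivity)]
        congr 1
        ring

theorem exists_lintegral_ball_norm_rpow_le {a : ℝ} (ha : -2 < a) :
    ∃ A : ℝ, 0 < A ∧ ∀ (x : E2) (s : ℝ), 0 < s →
      ∫⁻ y in Metric.ball x s, ENNReal.ofReal (‖y‖ ^ a)
        ≤ ENNReal.ofReal (A * s ^ 2 * (‖x‖ + s) ^ a) := by
  have ha2 : 0 < a + 2 := by linarith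
  rcases le_or_gt 0 a with h0 | h0
  · refine ⟨π, pi_pos, fun x s hs =>
      lintegral_ball_norm_rpow_le_of_forall_le x hs fun y hy => ?_⟩
    refine rpow_le_rpow (norm_nonneg _) ?_ h0
    have := norm_le_norm_add_norm_sub' y x
    rw [Metric.mem_ball, dist_eq_norm] at hy
    linarith
  · refine ⟨π * 3 ^ (-a) + 18 * π / (a + 2), by positivity, fun x s hs => ?_⟩
    have hX : 0 < ‖x‖ + s := by positivity
    have hXa : 0 < (‖x‖ + s) ^ a := rpow_pos_of_pos hX a
    rcases le_or_gt (2 * s) ‖x‖ with hx | hx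
    · refine (lintegral_ball_norm_rpow_le_of_forall_le (M := 3 ^ (-a) * (‖x‖ + s) ^ a)
        x hs fun y hy => ?_).trans (ENNReal.ofReal_le_ofReal ?_)
      · have h1 : (‖x‖ + s) / 3 ≤ ‖y‖ := by
          have := norm_le_norm_add_norm_sub y x
          rw [Metric.mem_ball, dist_eq_norm] at hy
          linarith
        refine (rpow_le_rpow_of_nonpos (by positivity) h1 h0.le).trans_eq ?_
        rw [div_rpow hX.le (by norm_num), rpow_neg (by norm_num)]
        ring
      · have : 0 ≤ 18 * π / (a + 2) * (s ^ 2 * (‖x‖ + s) ^ a) := by positivity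
        nlinarith
    · have hsub : Metric.ball x s ⊆ Metric.ball 0 (3 * s) := by
        refine Metric.ball_subset_ball' ?_
        rw [dist_zero_right]
        linarith
      refine (lintegral_mono_set hsub).trans ?_
      rw [lintegral_ball_zero_norm_rpow ha (by positivity)]
      refine ENNReal.ofReal_le_ofReal ?_
      have h1 : (3 * s) ^ a ≤ (‖x‖ + s) ^ a :=
        rpow_le_rpow_of_nonpos hX (by linarith) h0.le
      rw [rpow_add (by positivity), rpow_two]
      calc 2 * π / (a + 2) * ((3 * s) ^ a * (3 * s) ^ 2)
          = 18 * π / (a + 2) * s ^ 2 * (3 * s) ^ a := by ring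
        _ ≤ 18 * π / (a + 2) * s ^ 2 * (‖x‖ + s) ^ a := by gcongr
        _ ≤ (π * 3 ^ (-a) + 18 * π / (a + 2)) * s ^ 2 * (‖x‖ + s) ^ a := by
          gcongr
          exact le_add_of_nonneg_left (by positivity)

theorem rhoD_nonneg (κ : ℝ) (x : E2) : 0 ≤ rhoD κ x := Metric.infDist_nonneg

theorem rhoD_le_rhoD_add_dist (κ : ℝ) (x y : E2) : rhoD κ x ≤ rhoD κ y + dist x y :=
  Metric.infDist_le_infDist_add_dist

theorem continuous_rhoD (κ : ℝ) : Continuous (rhoD κ) := Metric.continuous_infDist_pt _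

theorem norm_pos_of_mem_Dset {κ : ℝ} {x : E2} (hx : x ∈ Dset κ) : 0 < ‖x‖ := by
  rw [norm_pos_iff]
  rintro rfl
  obtain ⟨r, φ, hr, -, -, h0, h1⟩ := hx
  simp only [PiLp.zero_apply, zero_eq_mul, hr.ne', false_or] at h0 h1
  have := sin_sq_add_cos_sq φ
  simp [h0, h1] at this

/-- The upper bound on the `w_{2,2λ}`-measure of balls expected from the size of the weight. -/
theorem exists_wMeas_ballD_le (κ : ℝ) {lam : ℝ} (hlam : 0 < lam) :
    ∃ A : ℝ, 0 < A ∧ ∀ (x : E2) (s : ℝ), 0 < s →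
      wMeas κ 2 (2 * lam) (ballD κ x s)
        ≤ ENNReal.ofReal (A * s ^ 2 * (‖x‖ + s) ^ (2 * lam - 2) * (rhoD κ x + s) ^ 2) := by
  obtain ⟨A, hA, h⟩ := exists_lintegral_ball_norm_rpow_le (a := 2 * lam - 2) (by linarith)
  refine ⟨A, hA, fun x s hs => ?_⟩
  have hmeas : Measurable fun y : E2 => ENNReal.ofReal (‖y‖ ^ (2 * lam - 2)) := by fun_prop
  calc wMeas κ 2 (2 * lam) (ballD κ x s)
      ≤ ∫⁻ y in Metric.ball x s, ENNReal.ofReal (wgt κ 2 (2 * lam) y) :=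
        lintegral_mono_set fun y hy => hy.2
    _ ≤ ∫⁻ y in Metric.ball x s,
          ENNReal.ofReal (‖y‖ ^ (2 * lam - 2)) * ENNReal.ofReal ((rhoD κ x + s) ^ 2) := by
        refine setLIntegral_mono (hmeas.mul_const _) fun y hy => ?_
        rw [← ENNReal.ofReal_mul (by positivity)]
        refine ENNReal.ofReal_le_ofReal ?_
        rw [wgt, rpow_two]
        have h1 := rhoD_le_rhoD_add_dist κ y x
        have h2 := Metric.mem_ball.1 hy
        have h3 := rhoD_nonneg κ y
        gcongr
        linarith
    _ = (∫⁻ y in Metric.ball x s, ENNReal.ofReal (‖y‖ ^ (2 * lam - 2))) *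
          ENNReal.ofReal ((rhoD κ x + s) ^ 2) := lintegral_mul_const _ hmeas
    _ ≤ ENNReal.ofReal (A * s ^ 2 * (‖x‖ + s) ^ (2 * lam - 2)) *
          ENNReal.ofReal ((rhoD κ x + s) ^ 2) := by
        gcongr
        exact h x s hs
    _ = _ := (ENNReal.ofReal_mul (by positivity)).symm

theorem wMeas_ballD_pos {κ γ ν s : ℝ} {x : E2} (hx : x ∈ Dset κ) (hρ : 0 < rhoD κ x)
    (hs : 0 < s) : 0 < wMeas κ γ ν (ballD κ x s) := by
  have hmeas : Measurable fun y : E2 => ENNReal.ofReal (wgt κ γ ν y) := by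
    have := (continuous_rhoD κ).measurable
    unfold wgt
    fun_prop
  rw [wMeas, setLIntegral_pos_iff hmeas]
  have hxi : x ∈ interior (Dset κ) := by
    by_contra hxi
    have hxf : x ∈ frontier (Dset κ) := ⟨subset_closure hx, hxi⟩
    exact hρ.ne' (Metric.infDist_zero_of_mem hxf)
  refine Measure.measure_pos_of_mem_nhds volume (x := x) ?_
  filter_upwards [mem_interior_iff_mem_nhds.1 hxi, Metric.ball_mem_nhds x hs,
    (continuous_rhoD κ).continuousAt.eventually_const_lt hρ] with y hyD hyb hyρ
  refine ⟨?_, hyD, hyb⟩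
  have := norm_pos_of_mem_Dset hyD
  simp only [Function.mem_support, ne_eq, ENNReal.ofReal_eq_zero, not_le]
  unfold wgt
  positivity

theorem one_add_rpow_mul_exp_neg_sq_le {b δ u : ℝ} (hb : 0 ≤ b) (hδ : 0 < δ) (hu : 0 ≤ u) :
    (1 + u) ^ b * exp (-δ * u ^ 2) ≤ exp (b ^ 2 / (4 * δ)) := by
  calc (1 + u) ^ b * exp (-δ * u ^ 2)
      ≤ exp u ^ b * exp (-δ * u ^ 2) := by
        gcongr
        linarith [add_one_le_exp u]
    _ = exp (u * b - δ * u ^ 2) := by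
        rw [← exp_mul, ← exp_add]
        ring_nf
    _ ≤ exp (b ^ 2 / (4 * δ)) := by
        rw [exp_le_exp, le_div_iff₀ (by positivity)]
        nlinarith [sq_nonneg (b - 2 * δ * u)]

/-- Comparison of powers of two positive numbers whose ratio is controlled both ways. -/
theorem rpow_le_rpow_mul_rpow_abs {X Y m : ℝ} (hX : 0 < X) (hY : 0 < Y) (hm : 1 ≤ m)
    (hXY : X ≤ Y * m) (hYX : Y ≤ X * m) (p : ℝ) : Y ^ p ≤ X ^ p * m ^ |p| := by
  have hm0 : 0 < m := by linarith
  rcases le_or_gt 0 p with hp | hp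
  · rw [abs_of_nonneg hp, ← mul_rpow hX.le hm0.le]
    exact rpow_le_rpow hY.le hYX hp
  · rw [abs_of_neg hp, rpow_neg hm0.le, ← div_eq_mul_inv, ← div_rpow hX.le hm0.le]
    exact rpow_le_rpow_of_nonpos (by positivity) ((div_le_iff₀ hm0).2 hXY) hp.le

theorem add_le_add_mul_one_add_div {a b d s : ℝ} (hb : 0 ≤ b) (hd : 0 ≤ d) (hs : 0 < s)
    (h : a ≤ b + d) : a + s ≤ (b + s) * (1 + d / s) := by
  have h1 : (b + s) * (1 + d / s) = b + s + d + b * (d / s) := by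
    field_simp
    ring
  have h2 : 0 ≤ b * (d / s) := by positivity
  linarith

/-- Dividing the kernel bound by the weights cancels the vanishing factors. -/
theorem kernelBound_div_weights {C₀ lam a b p q s e t : ℝ} (ha : 0 < a) (hb : 0 < b)
    (hp : 0 < p) (hq : 0 < q) (hs : 0 < s) :
    C₀ * ((a / (a + s)) ^ (lam - 1) * (b / (b + s)) ^ (lam - 1) * (p / (p + s)) *
        (q / (q + s)) * e / t) / ((a ^ (lam - 1) * p) * (b ^ (lam - 1) * q))
      = C₀ * ((a + s) ^ (1 - lam) * (b + s) ^ (1 - lam) * (p + s)⁻¹ * (q + s)⁻¹ * e / t) := by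
  have h1 : (a + s) ^ (1 - lam) = ((a + s) ^ (lam - 1))⁻¹ := by
    rw [← rpow_neg (by positivity)]
    ring_nf
  have h2 : (b + s) ^ (1 - lam) = ((b + s) ^ (lam - 1))⁻¹ := by
    rw [← rpow_neg (by positivity)]
    ring_nf
  rw [h1, h2, div_rpow ha.le (by positivity), div_rpow hb.le (by positivity)]
  have h3 := (rpow_pos_of_pos ha (lam - 1)).ne'
  have h4 := (rpow_pos_of_pos hb (lam - 1)).ne'
  field_simp

theorem stmt7 (κ : ℝ) (hκ : 0 < κ) (hκ' : κ < 2 * π)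
    (lam cBig c C₀ : ℝ) (hlam : 0 < lam) (hlam' : lam < π / κ)
    (hcBig : 0 < cBig) (hc : 0 < c) (hccBig : c < cBig) (hC₀ : 0 < C₀)
    (K : ℝ → E2 → E2 → ℝ) (hK0 : ∀ t x y, 0 ≤ K t x y)
    (hK : ∀ t : ℝ, 0 < t → ∀ x ∈ Dset κ, ∀ y ∈ Dset κ,
      K t x y ≤ C₀ * ((‖x‖ / (‖x‖ + Real.sqrt t)) ^ (lam - 1) *
        (‖y‖ / (‖y‖ + Real.sqrt t)) ^ (lam - 1) *
        (rhoD κ x / (rhoD κ x + Real.sqrt t)) * (rhoD κ y / (rhoD κ y + Real.sqrt t)) *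
        Real.exp (-cBig * dist x y ^ 2 / t) / t)) :
    ∃ C : ℝ, 0 < C ∧ ∀ t : ℝ, 0 < t → ∀ x ∈ Dset κ, ∀ y ∈ Dset κ,
      K t x y / ((‖x‖ ^ (lam - 1) * rhoD κ x) * (‖y‖ ^ (lam - 1) * rhoD κ y))
        ≤ C * (Real.exp (-c * dist x y ^ 2 / t) /
            (wMeas κ 2 (2 * lam) (ballD κ x (Real.sqrt t))).toReal) := by
  obtain ⟨A, hA, hW⟩ := exists_wMeas_ballD_le κ hlam
  have hδ : 0 < cBig - c := sub_pos.2 hccBig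
  set M : ℝ := exp ((|1 - lam| + 1) ^ 2 / (4 * (cBig - c)))
  refine ⟨C₀ * M * A, by positivity, fun t ht x hx y hy => ?_⟩
  rcases (rhoD_nonneg κ x).eq_or_lt with hρx | hρx
  · rw [← hρx]
    simp only [mul_zero, zero_mul, div_zero]
    positivity
  rcases (rhoD_nonneg κ y).eq_or_lt with hρy | hρy
  · rw [← hρy]
    simp only [mul_zero, div_zero]
    positivity
  have hnx := norm_pos_of_mem_Dset hx
  have hny := norm_pos_of_mem_Dset hy
  have hs : 0 < √t := sqrt_pos.2 ht
  have hst : √t ^ 2 = t := sq_sqrt ht.le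
  have hWx := hW x (√t) hs
  have hWpos := ENNReal.toReal_pos (wMeas_ballD_pos (γ := 2) (ν := 2 * lam) hx hρx hs).ne'
    (hWx.trans_lt ENNReal.ofReal_lt_top).ne
  replace hWx := ENNReal.toReal_le_of_le_ofReal (by positivity) hWx
  set W := (wMeas κ 2 (2 * lam) (ballD κ x √t)).toReal
  refine (div_le_div_of_nonneg_right (hK t ht x hx y hy) (by positivity)).trans ?_
  rw [kernelBound_div_weights hnx hny hρx hρy hs]
  set d := dist x y with hd
  have hd0 : 0 ≤ d := dist_nonneg
  set m := 1 + d / √t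
  have hm1 : 1 ≤ m := le_add_of_nonneg_right (by positivity)
  have hm0 : 0 < m := by linarith
  have hnxy : ‖x‖ ≤ ‖y‖ + d := by
    rw [hd, dist_eq_norm]
    exact norm_le_norm_add_norm_sub y x |>.trans_eq (by rw [norm_sub_rev])
  have hnyx : ‖y‖ ≤ ‖x‖ + d := by
    rw [hd, dist_comm, dist_eq_norm]
    exact norm_le_norm_add_norm_sub x y |>.trans_eq (by rw [norm_sub_rev])
  have hY : (‖y‖ + √t) ^ (1 - lam) ≤ (‖x‖ + √t) ^ (1 - lam) * m ^ |1 - lam| :=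
    rpow_le_rpow_mul_rpow_abs (by positivity) (by positivity) hm1
      (add_le_add_mul_one_add_div hny.le hd0 hs hnxy)
      (add_le_add_mul_one_add_div hnx.le hd0 hs hnyx) _
  have hQ : (rhoD κ y + √t)⁻¹ ≤ (rhoD κ x + √t)⁻¹ * m := by
    have := add_le_add_mul_one_add_div hρy.le hd0 hs (rhoD_le_rhoD_add_dist κ x y)
    rw [inv_mul_eq_div, inv_eq_one_div, div_le_div_iff₀ (by positivity) (by positivity)]
    linarith
  have hexp : m ^ (|1 - lam| + 1) * exp (-cBig * d ^ 2 / t) ≤ M * exp (-c * d ^ 2 / t) := by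
    have h := one_add_rpow_mul_exp_neg_sq_le (b := |1 - lam| + 1) (u := d / √t)
      (by positivity) hδ (by positivity)
    have hsplit : exp (-cBig * d ^ 2 / t)
        = exp (-(cBig - c) * (d / √t) ^ 2) * exp (-c * d ^ 2 / t) := by
      rw [← exp_add, div_pow, hst]
      ring_nf
    rw [hsplit, ← mul_assoc]
    gcongr
  have hX2 : (‖x‖ + √t) ^ (1 - lam) * (‖x‖ + √t) ^ (1 - lam)
      = ((‖x‖ + √t) ^ (2 * lam - 2))⁻¹ := by
    rw [← rpow_add (by positivity), ← rpow_neg (by positivity)]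
    ring_nf
  have hXp : 0 < (‖x‖ + √t) ^ (2 * lam - 2) := by positivity
  calc C₀ * ((‖x‖ + √t) ^ (1 - lam) * (‖y‖ + √t) ^ (1 - lam) * (rhoD κ x + √t)⁻¹ *
        (rhoD κ y + √t)⁻¹ * exp (-cBig * d ^ 2 / t) / t)
      ≤ C₀ * ((‖x‖ + √t) ^ (1 - lam) * ((‖x‖ + √t) ^ (1 - lam) * m ^ |1 - lam|) *
        (rhoD κ x + √t)⁻¹ * ((rhoD κ x + √t)⁻¹ * m) * exp (-cBig * d ^ 2 / t) / t) := by
        gcongr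
    _ = C₀ * (((‖x‖ + √t) ^ (1 - lam) * (‖x‖ + √t) ^ (1 - lam)) *
        ((rhoD κ x + √t)⁻¹) ^ 2 * (m ^ (|1 - lam| + 1) * exp (-cBig * d ^ 2 / t)) / t) := by
        rw [rpow_add hm0, rpow_one]
        ring
    _ ≤ C₀ * (((‖x‖ + √t) ^ (1 - lam) * (‖x‖ + √t) ^ (1 - lam)) *
        ((rhoD κ x + √t)⁻¹) ^ 2 * (M * exp (-c * d ^ 2 / t)) / t) := by
        gcongr
    _ = C₀ * M * A * (exp (-c * d ^ 2 / t) /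
        (A * √t ^ 2 * (‖x‖ + √t) ^ (2 * lam - 2) * (rhoD κ x + √t) ^ 2)) := by
        rw [hX2, hst]
        field_simp
    _ ≤ C₀ * M * A * (exp (-c * d ^ 2 / t) / W) := by
        gcongr
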